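/- Let χ be a primitive Dirichlet character (mod n) and let s be an integer. Then Σ_{k=1}^{n} σ(gcd(k − s, n)) χ(k) = n · χ(s), where σ is the sum-of-divisors function. -/

import Mathlib

open Finset ArithmeticFunction

/-- A function on `ZMod n` may be summed along the residues `1, …, n`. -/
theorem ZMod.sum_Icc_natCast {M : Type*} [AddCommMonoid M] (n : ℕ) [NeZero n] (f : ZMod n → M) :
    ∑ k ∈ Finset.Icc 1 n, f (k : ZMod n) = ∑ x : ZMod n, f x := by
  have hinj : Set.InjOn (fun k : ℕ ↦ (k : ZMod n)) (Finset.Icc 1 n) := by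
    intro a ha b hb hab
    simp only [coe_Icc, Set.mem_Icc] at ha hb
    obtain ⟨c, hc⟩ := (ZMod.intCast_eq_intCast_iff_dvd_sub (a : ℤ) (b : ℤ) n).1 (by simpa using hab)
    have h₁ : c < 1 := by by_contra! h; nlinarith
    have h₂ : -1 < c := by by_contra! h; nlinarith
    obtain rfl : c = 0 := by omega
    lia
  refine Finset.sum_nbij (fun k : ℕ ↦ (k : ZMod n)) (fun _ _ ↦ mem_univ _) hinj ?_ (fun _ _ ↦ rfl)
  exact Finset.surjOn_of_injOn_of_card_le _ (fun _ _ ↦ mem_univ _) hinj (by simp [ZMod.card])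

theorem ZMod.natCast_dvd_intCast_iff {n d : ℕ} (hd : d ∣ n) (a : ℤ) :
    (d : ZMod n) ∣ (a : ZMod n) ↔ (d : ℤ) ∣ a := by
  constructor
  · rintro ⟨c, hc⟩
    have h := congrArg (ZMod.castHom hd (ZMod d)) hc
    rw [map_mul, map_intCast, map_natCast, CharP.cast_eq_zero, zero_mul] at h
    exact (CharP.intCast_eq_zero_iff (ZMod d) d a).1 h
  · rintro ⟨c, rfl⟩
    exact ⟨c, by push_cast; rfl⟩

/-- A primitive character sums to zero over every residue class modulo a proper divisor of its
level. -/
theorem DirichletCharacter.IsPrimitive.sum_residueClass_eq_zero {R : Type*} [CommRing R]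
    [IsDomain R] {n d : ℕ} [NeZero n] {χ : DirichletCharacter R n} (hχ : χ.IsPrimitive)
    (hd : d ∣ n) (hdn : d ≠ n) (s : ZMod n) [DecidablePred fun x : ZMod n ↦ (d : ZMod n) ∣ x - s] :
    ∑ x : ZMod n, (if (d : ZMod n) ∣ x - s then χ x else 0) = 0 := by
  have hnot : ¬ χ.FactorsThrough d := fun h ↦ by
    have hcd := DirichletCharacter.conductor_dvd_of_mem_conductorSet χ h
    rw [hχ] at hcd
    exact hdn (Nat.dvd_antisymm hd hcd)
  rw [χ.factorsThrough_iff_ker_unitsMap hd, SetLike.not_le_iff_exists] at hnot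
  obtain ⟨u, hu, huχ⟩ := hnot
  have hu1 : (d : ZMod n) ∣ (u : ZMod n) - 1 := by
    have h : ((u : ZMod n).cast : ZMod d) = 1 := by
      simpa [ZMod.unitsMap_def] using congrArg Units.val (MonoidHom.mem_ker.1 hu)
    have h' := (ZMod.natCast_dvd_intCast_iff hd (((u : ZMod n).val : ℤ) - 1)).2 <| by
      rw [← CharP.intCast_eq_zero_iff (ZMod d)]
      simpa [sub_eq_zero, ZMod.natCast_val] using h
    simpa using h'
  have hχu : χ u ≠ 1 := fun h ↦ huχ <| MonoidHom.mem_ker.2 <| Units.ext <| by simpa using h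
  refine eq_zero_of_mul_eq_self_left hχu ?_
  rw [mul_sum]
  refine Fintype.sum_equiv u.mulLeft _ _ fun x ↦ ?_
  have hx : (d : ZMod n) ∣ (u : ZMod n) * x - s ↔ (d : ZMod n) ∣ x - s := by
    rw [show (u : ZMod n) * x - s = ((u : ZMod n) - 1) * x + (x - s) by ring]
    exact dvd_add_right (hu1.mul_right x)
  simp [hx]

/-- Let `χ` be a primitive Dirichlet character (mod `n`) and let `s` be an integer.  Then
`∑_{k=1}^{n} σ (gcd (k - s) n) χ(k) = n · χ(s)`, where `σ` is the sum-of-divisors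
function. -/
theorem menon_primitive_character_sigma (n : ℕ) (hn : 0 < n)
    (χ : DirichletCharacter ℂ n) (hprim : χ.IsPrimitive) (s : ℤ) :
    ∑ k ∈ Finset.Icc 1 n, ((sigma 1) (Int.gcd ((k : ℤ) - s) (n : ℤ)) : ℂ) * χ (k : ZMod n)
      = (n : ℂ) * χ ((s : ℤ) : ZMod n) := by
  classical
  have : NeZero n := ⟨hn.ne'⟩
  have hsigma (k : ℕ) : ((sigma 1) (Int.gcd ((k : ℤ) - s) (n : ℤ)) : ℂ) * χ (k : ZMod n) =
      ∑ d ∈ n.divisors, d * if (d : ZMod n) ∣ (k : ZMod n) - (s : ZMod n) then χ k else 0 := by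
    have hdiv : (Int.gcd ((k : ℤ) - s) (n : ℤ)).divisors =
        n.divisors.filter fun d : ℕ ↦ (d : ZMod n) ∣ (k : ZMod n) - (s : ZMod n) := by
      ext d
      have hd (h : d ∣ n) := ZMod.natCast_dvd_intCast_iff h ((k : ℤ) - s)
      push_cast at hd
      have hgcd : d ∣ Int.gcd ((k : ℤ) - s) n ↔ (d : ℤ) ∣ (k : ℤ) - s ∧ d ∣ n := by
        rw [Int.dvd_gcd_iff, Int.natCast_dvd_natCast]
      have hne : Int.gcd ((k : ℤ) - s) n ≠ 0 := by simp [Int.gcd_eq_zero_iff, hn.ne']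
      rw [Nat.mem_divisors, mem_filter, Nat.mem_divisors, hgcd]
      have := hn.ne'
      tauto
    rw [sigma_one_apply, hdiv, Nat.cast_sum, sum_mul, sum_filter]
    exact sum_congr rfl fun d _ ↦ by split_ifs <;> simp
  simp only [hsigma]
  rw [sum_comm, sum_eq_single_of_mem n (Nat.mem_divisors_self n hn.ne')]
  · rw [← mul_sum, ZMod.sum_Icc_natCast n
      fun x ↦ if (n : ZMod n) ∣ x - (s : ZMod n) then χ x else 0]
    simp [sub_eq_zero]
  · intro d hd hdn
    rw [← mul_sum, ZMod.sum_Icc_natCast n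
      fun x ↦ if (d : ZMod n) ∣ x - (s : ZMod n) then χ x else 0,
      hprim.sum_residueClass_eq_zero (Nat.dvd_of_mem_divisors hd) hdn, mul_zero]
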